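/- arXiv:2501.13093 — 2 statements merged into one kernel-verified Lean document; each statement's English description precedes it below -/
import Mathlib

section
/- If C is a K-clustering of X that is both weakly separable and LM-separable for N_p, then C is the unique such K-clustering: every K-clustering of X (with the same number K = |C| of clusters) that is weakly separable and LM-separable for N_p is equal to C. -/
variable {α : Type*}

/-- Sparsity ε_{N_p}(x): smallest ε ≥ 0 such that at least N_p points of X lie within
distance ε of x. -/
noncomputable def sparsity [MetricSpace α] (X : Finset α) (Np : ℕ) (x : α) : ℝ :=
  sInf {ε : ℝ | 0 ≤ ε ∧ Np ≤ (X.filter (fun y => dist x y ≤ ε)).card}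

/-- x is ε-connected to y: there is a finite sequence of points of X from x to y,
each of sparsity at most ε, with consecutive distances at most ε. -/
def EpsConn [MetricSpace α] (X : Finset α) (Np : ℕ) (ε : ℝ) (x y : α) : Prop :=
  x ∈ X ∧ sparsity X Np x ≤ ε ∧
    Relation.ReflTransGen (fun a b => b ∈ X ∧ sparsity X Np b ≤ ε ∧ dist a b ≤ ε) x y

/-- A set c is ε-connected if every pair of points of c is ε-connected. -/
def SetConn [MetricSpace α] (X : Finset α) (Np : ℕ) (ε : ℝ) (c : Finset α) : Prop :=
  ∀ x ∈ c, ∀ y ∈ c, EpsConn X Np ε x y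

/-- ε*(c): the minimum ε such that c is ε-connected. -/
noncomputable def setSparsity [MetricSpace α] (X : Finset α) (Np : ℕ) (c : Finset α) : ℝ :=
  sInf {ε : ℝ | SetConn X Np ε c}

/-- ε(x,y): the minimum ε such that x is ε-connected to y. -/
noncomputable def epsDist [MetricSpace α] (X : Finset α) (Np : ℕ) (x y : α) : ℝ :=
  sInf {ε : ℝ | EpsConn X Np ε x y}

/-- ε(x,c): min over y ∈ c of ε(x,y). -/
noncomputable def ptClusterDist [MetricSpace α] (X : Finset α) (Np : ℕ) (x : α)
    (c : Finset α) : ℝ :=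
  sInf {e : ℝ | ∃ y ∈ c, e = epsDist X Np x y}

/-- ε(c,c'): min over x ∈ c, y ∈ c' of ε(x,y). -/
noncomputable def clusterDist [MetricSpace α] (X : Finset α) (Np : ℕ)
    (c c' : Finset α) : ℝ :=
  sInf {e : ℝ | ∃ x ∈ c, ∃ y ∈ c', e = epsDist X Np x y}

/-- A clustering of X: a partition of X into nonempty clusters. -/
def IsClustering (X : Finset α) (C : Finset (Finset α)) : Prop :=
  (∀ c ∈ C, c.Nonempty) ∧ (∀ c ∈ C, ∀ c' ∈ C, c ≠ c' → Disjoint c c') ∧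
    (∀ c ∈ C, c ⊆ X) ∧ (∀ x ∈ X, ∃ c ∈ C, x ∈ c)

/-- C is weakly separable: for each cluster c, ε*(c) < min over c' ≠ c of ε(c,c'). -/
def WeaklySeparable [MetricSpace α] (X : Finset α) (Np : ℕ) (C : Finset (Finset α)) : Prop :=
  ∀ c ∈ C, ∀ c' ∈ C, c' ≠ c → setSparsity X Np c < clusterDist X Np c c'

/-- c is an ε-cluster: a (nonempty) maximal ε-connected subset of X. -/
def IsEpsCluster [MetricSpace α] (X : Finset α) (Np : ℕ) (ε : ℝ) (c : Finset α) : Prop :=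
  c.Nonempty ∧ SetConn X Np ε c ∧ ∀ x ∈ X, (∃ y ∈ c, EpsConn X Np ε x y) → x ∈ c

/-- c is a maximal cluster: an ε-cluster for some ε ≥ 0. -/
def IsMaximalCluster [MetricSpace α] (X : Finset α) (Np : ℕ) (c : Finset α) : Prop :=
  ∃ ε : ℝ, 0 ≤ ε ∧ IsEpsCluster X Np ε c

/-- x is a local maximum: every y ∈ X with d(x,y) ≤ ε_{N_p}(x) has sparsity ≥ that of x. -/
def IsLocalMaxPt [MetricSpace α] (X : Finset α) (Np : ℕ) (x : α) : Prop :=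
  x ∈ X ∧ ∀ y ∈ X, dist x y ≤ sparsity X Np x → sparsity X Np x ≤ sparsity X Np y

/-- X_c*: the points of c of minimum sparsity within c. -/
noncomputable def minSparsityPts [MetricSpace α] (X : Finset α) (Np : ℕ)
    (c : Finset α) : Finset α :=
  c.filter (fun x => ∀ y ∈ c, sparsity X Np x ≤ sparsity X Np y)

/-- Relative separability A(x,y) = ε(x,y) / ε_{N_p}(x). -/
noncomputable def relSep [MetricSpace α] (X : Finset α) (Np : ℕ) (x y : α) : ℝ :=
  epsDist X Np x y / sparsity X Np x

/-- A(x,c) = min over y ∈ c of A(x,y). -/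
noncomputable def relSepCluster [MetricSpace α] (X : Finset α) (Np : ℕ) (x : α)
    (c : Finset α) : ℝ :=
  sInf {a : ℝ | ∃ y ∈ c, a = relSep X Np x y}

/-- A^ℓ(C): the minimum A such that for every local maximum x, every y in the cluster of x
with sparsity at most that of x satisfies A(x,y) ≤ A. -/
noncomputable def Aell [MetricSpace α] (X : Finset α) (Np : ℕ)
    (C : Finset (Finset α)) : ℝ :=
  sInf {A : ℝ | ∀ x ∈ X, IsLocalMaxPt X Np x → ∀ c ∈ C, x ∈ c →
    ∀ y ∈ c, sparsity X Np y ≤ sparsity X Np x → relSep X Np x y ≤ A}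

/-- C is LM-separable: A^ℓ(C) < min over distinct clusters c, c' and z ∈ X_c* of A(z,c'). -/
def LMSeparable [MetricSpace α] (X : Finset α) (Np : ℕ) (C : Finset (Finset α)) : Prop :=
  ∀ c ∈ C, ∀ c' ∈ C, c ≠ c' → ∀ z ∈ minSparsityPts X Np c,
    Aell X Np C < relSepCluster X Np z c'

/-- min over x ∈ c of ε_{N_p}(x). -/
noncomputable def minSpars [MetricSpace α] (X : Finset α) (Np : ℕ) (c : Finset α) : ℝ :=
  sInf (sparsity X Np '' (c : Set α))

/-- max over x ∈ c of ε_{N_p}(x). -/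
noncomputable def maxSpars [MetricSpace α] (X : Finset α) (Np : ℕ) (c : Finset α) : ℝ :=
  sSup (sparsity X Np '' (c : Set α))

/-- C is strongly separable: there is an A such that each cluster c is
(A · min sparsity of c)-connected and A · min sparsity of c < min over c' ≠ c of ε(c,c'). -/
def StronglySeparable [MetricSpace α] (X : Finset α) (Np : ℕ)
    (C : Finset (Finset α)) : Prop :=
  ∃ A : ℝ, ∀ c ∈ C, SetConn X Np (A * minSpars X Np c) c ∧
    ∀ c' ∈ C, c' ≠ c → A * minSpars X Np c < clusterDist X Np c c'

/-- c*(x,ε): the set of points of X that are ε-connected to x. -/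
def epsClusterAt [MetricSpace α] (X : Finset α) (Np : ℕ) (ε : ℝ) (x : α) : Set α :=
  {y | EpsConn X Np ε x y}

theorem EpsConn.right_mem [MetricSpace α] {X : Finset α} {Np : ℕ} {ε : ℝ} {x y : α}
    (h : EpsConn X Np ε x y) : y ∈ X := by
  rcases Relation.ReflTransGen.cases_tail h.2.2 with rfl | ⟨_, _, hb⟩
  exacts [h.1, hb.1]

theorem epsDist_le_of_epsConn [MetricSpace α] {X : Finset α} {Np : ℕ} {ε : ℝ} {x y : α}
    (h : EpsConn X Np ε x y) : epsDist X Np x y ≤ ε :=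
  csInf_le ⟨sparsity X Np x, fun _ hε => hε.2.1⟩ h

theorem exists_setConn [MetricSpace α] (X : Finset α) (Np : ℕ) {c : Finset α} (hc : c ⊆ X) :
    ∃ ε, SetConn X Np ε c := by
  obtain ⟨M, hM⟩ := (X.finite_toSet.image (sparsity X Np)).bddAbove
  obtain ⟨D, hD⟩ := ((X ×ˢ X).finite_toSet.image fun p => dist p.1 p.2).bddAbove
  have hs : ∀ x ∈ X, sparsity X Np x ≤ max M D := fun x hx =>
    (hM ⟨x, hx, rfl⟩).trans (le_max_left _ _)
  have hd : ∀ x ∈ X, ∀ y ∈ X, dist x y ≤ max M D := fun x hx y hy =>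
    (hD ⟨(x, y), by simp [hx, hy], rfl⟩).trans (le_max_right _ _)
  exact ⟨max M D, fun x hx y hy => ⟨hc hx, hs x (hc hx),
    .single ⟨hc hy, hs y (hc hy), hd x (hc hx) y (hc hy)⟩⟩⟩

theorem epsDist_le_setSparsity [MetricSpace α] {X : Finset α} {Np : ℕ} {c : Finset α} {x y : α}
    (hc : c ⊆ X) (hx : x ∈ c) (hy : y ∈ c) : epsDist X Np x y ≤ setSparsity X Np c :=
  le_csInf (exists_setConn X Np hc) fun _ h => epsDist_le_of_epsConn (h x hx y hy)

theorem sparsity_le_setSparsity [MetricSpace α] {X : Finset α} {Np : ℕ} {c : Finset α} {x : α}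
    (hc : c ⊆ X) (hx : x ∈ c) : sparsity X Np x ≤ setSparsity X Np c :=
  le_csInf (exists_setConn X Np hc) fun _ h => (h x hx x hx).2.1

theorem clusterDist_le_epsDist [MetricSpace α] {X : Finset α} {Np : ℕ} {c c' : Finset α}
    {x y : α} (hx : x ∈ c) (hy : y ∈ c') : clusterDist X Np c c' ≤ epsDist X Np x y := by
  refine csInf_le (Set.Finite.bddBelow ?_) ⟨x, hx, y, hy, rfl⟩
  refine ((c ×ˢ c').finite_toSet.image fun p => epsDist X Np p.1 p.2).subset ?_
  rintro _ ⟨a, ha, b, hb, rfl⟩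
  exact ⟨(a, b), by simp [ha, hb], rfl⟩

theorem relSepCluster_le_relSep [MetricSpace α] {X : Finset α} {Np : ℕ} {c : Finset α}
    {x y : α} (hy : y ∈ c) : relSepCluster X Np x c ≤ relSep X Np x y := by
  refine csInf_le (Set.Finite.bddBelow ?_) ⟨y, hy, rfl⟩
  refine (c.finite_toSet.image (relSep X Np x)).subset ?_
  rintro _ ⟨a, ha, rfl⟩
  exact ⟨a, ha, rfl⟩

theorem relSep_le_Aell [MetricSpace α] {X : Finset α} {Np : ℕ} {C : Finset (Finset α)}
    (hC : IsClustering X C) {c : Finset α} (hc : c ∈ C) {x y : α} (hx : x ∈ c) (hy : y ∈ c)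
    (hmax : IsLocalMaxPt X Np x) (hyx : sparsity X Np y ≤ sparsity X Np x) :
    relSep X Np x y ≤ Aell X Np C := by
  refine le_csInf ?_ fun A hA => hA x hmax.1 hmax c hc hx y hy hyx
  obtain ⟨D, hD⟩ := ((X ×ˢ X).finite_toSet.image fun p => relSep X Np p.1 p.2).bddAbove
  exact ⟨D, fun a ha _ d hd _ b hb _ =>
    hD ⟨(a, b), by simp [ha, hC.2.2.1 d hd hb], rfl⟩⟩

theorem WeaklySeparable.mem_of_epsDist_le [MetricSpace α] {X : Finset α} {Np : ℕ}
    {C : Finset (Finset α)} (hC : IsClustering X C) (hW : WeaklySeparable X Np C)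
    {c : Finset α} (hc : c ∈ C) {x y : α} (hx : x ∈ c) (hy : y ∈ X)
    (h : epsDist X Np x y ≤ setSparsity X Np c) : y ∈ c := by
  obtain ⟨d, hd, hyd⟩ := hC.2.2.2 y hy
  by_contra hyc
  exact ((hW c hc d hd (by rintro rfl; exact hyc hyd)).trans_le
    (clusterDist_le_epsDist hx hyd)).not_ge h

theorem WeaklySeparable.subset_of_setSparsity_le [MetricSpace α] {X : Finset α} {Np : ℕ}
    {C : Finset (Finset α)} (hC : IsClustering X C) (hW : WeaklySeparable X Np C)
    {c d : Finset α} (hc : c ∈ C) (hd : d ⊆ X) {x : α} (hxc : x ∈ c) (hxd : x ∈ d)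
    (h : setSparsity X Np d ≤ setSparsity X Np c) : d ⊆ c := fun _ hy =>
  hW.mem_of_epsDist_le hC hc hxc (hd hy) ((epsDist_le_setSparsity hd hxd hy).trans h)

theorem WeaklySeparable.isLocalMaxPt [MetricSpace α] {X : Finset α} {Np : ℕ}
    {C : Finset (Finset α)} (hC : IsClustering X C) (hW : WeaklySeparable X Np C)
    {c : Finset α} (hc : c ∈ C) {z : α} (hz : z ∈ c)
    (hmin : ∀ y ∈ c, sparsity X Np z ≤ sparsity X Np y) : IsLocalMaxPt X Np z := by
  have hcX := hC.2.2.1 c hc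
  refine ⟨hcX hz, fun y hy hzy => ?_⟩
  by_contra! hlt
  have hconn : EpsConn X Np (sparsity X Np z) z y :=
    ⟨hcX hz, le_rfl, .single ⟨hy, hlt.le, hzy⟩⟩
  exact (hmin y (hW.mem_of_epsDist_le hC hc hz hy
    ((epsDist_le_of_epsConn hconn).trans (sparsity_le_setSparsity hcX hz)))).not_gt hlt

theorem IsClustering.eq_of_mem {X : Finset α} {C : Finset (Finset α)} (hC : IsClustering X C)
    {c d : Finset α} (hc : c ∈ C) (hd : d ∈ C) {x : α} (hxc : x ∈ c) (hxd : x ∈ d) : c = d := by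
  by_contra hne
  exact Finset.disjoint_left.mp (hC.2.1 c hc d hd hne) hxc hxd

/-- If the clusters of two distinct clusterings are pairwise nested or disjoint and the first
clustering has at most as many clusters as the second, then some cluster of the first contains two
distinct clusters of the second. -/
theorem IsClustering.exists_two_subset {X : Finset α} {C C' : Finset (Finset α)}
    (hC : IsClustering X C) (hC' : IsClustering X C') (hcard : C.card ≤ C'.card) (hne : C ≠ C')
    (hnest : ∀ c ∈ C, ∀ c' ∈ C', ∀ x ∈ c, x ∈ c' → c ⊆ c' ∨ c' ⊆ c) :
    ∃ c ∈ C, ∃ d ∈ C', ∃ e ∈ C', d ≠ e ∧ d ⊆ c ∧ e ⊆ c := by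
  by_contra! hcon
  have hsub : ∀ c ∈ C, ∃ c' ∈ C', c ⊆ c' := by
    intro c hc
    obtain ⟨x, hx⟩ := hC.1 c hc
    obtain ⟨d, hd, hxd⟩ := hC'.2.2.2 x (hC.2.2.1 c hc hx)
    refine ⟨d, hd, ?_⟩
    by_contra hcd
    have hdc := (hnest c hc d hd x hx hxd).resolve_left hcd
    obtain ⟨y, hy, hyd⟩ := Finset.not_subset.mp hcd
    obtain ⟨e, he, hye⟩ := hC'.2.2.2 y (hC.2.2.1 c hc hy)
    have hde : d ≠ e := by rintro rfl; exact hyd hye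
    rcases hnest c hc e he y hy hye with hce | hec
    · exact hde (hC'.eq_of_mem hd he hxd (hce hx))
    · exact hcon c hc d hd e he hde hdc hec
  choose f hf hfsub using hsub
  have hsurj : ∀ c' ∈ C', ∃ c, ∃ hc : c ∈ C, f c hc = c' := by
    intro c' hc'
    obtain ⟨x, hx⟩ := hC'.1 c' hc'
    obtain ⟨c, hc, hxc⟩ := hC.2.2.2 x (hC'.2.2.1 c' hc' hx)
    exact ⟨c, hc, hC'.eq_of_mem (hf c hc) hc' (hfsub c hc hxc) hx⟩
  have hinj := Finset.inj_on_of_surj_on_of_card_le f hf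
    (fun c' hc' => by simpa [eq_comm] using hsurj c' hc') hcard
  have hfix : ∀ c (hc : c ∈ C), f c hc = c := by
    refine fun c hc => (hfsub c hc).antisymm' fun y hy => ?_
    obtain ⟨d, hd, hyd⟩ := hC.2.2.2 y (hC'.2.2.1 _ (hf c hc) hy)
    have hdc := hinj hd hc (hC'.eq_of_mem (hf d hd) (hf c hc) (hfsub d hd hyd) hy)
    exact hdc ▸ hyd
  refine hne (Finset.Subset.antisymm (fun c hc => hfix c hc ▸ hf c hc) fun c' hc' => ?_)
  obtain ⟨c, hc, rfl⟩ := hsurj c' hc'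
  exact (hfix c hc).symm ▸ hc

theorem LMSeparable.Aell_lt_of_two_subset [MetricSpace α] {X : Finset α} {Np : ℕ}
    {C C' : Finset (Finset α)} (hC : IsClustering X C) (hC' : IsClustering X C')
    (hW' : WeaklySeparable X Np C') (hLM' : LMSeparable X Np C') {c d e : Finset α}
    (hc : c ∈ C) (hd : d ∈ C') (he : e ∈ C') (hde : d ≠ e) (hdc : d ⊆ c) (hec : e ⊆ c) :
    Aell X Np C' < Aell X Np C := by
  obtain ⟨z, hz, hzmin⟩ := d.exists_min_image (sparsity X Np) (hC'.1 d hd)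
  obtain ⟨w, hw, hwmin⟩ := e.exists_min_image (sparsity X Np) (hC'.1 e he)
  wlog hwz : sparsity X Np w ≤ sparsity X Np z generalizing d e z w
  · exact this he hd hde.symm hec hdc w hw hwmin z hz hzmin (le_of_not_ge hwz)
  calc Aell X Np C' < relSepCluster X Np z e :=
        hLM' d hd e he hde z (by simpa [minSparsityPts] using ⟨hz, hzmin⟩)
    _ ≤ relSep X Np z w := relSepCluster_le_relSep hw
    _ ≤ Aell X Np C := relSep_le_Aell hC hc (hdc hz) (hec hw)
        (hW'.isLocalMaxPt hC' hd hz hzmin) hwz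

theorem Aell_lt_of_ne [MetricSpace α] {X : Finset α} {Np : ℕ} {C C' : Finset (Finset α)}
    (hC : IsClustering X C) (hW : WeaklySeparable X Np C) (hC' : IsClustering X C')
    (hW' : WeaklySeparable X Np C') (hLM' : LMSeparable X Np C') (hcard : C.card = C'.card)
    (hne : C ≠ C') : Aell X Np C' < Aell X Np C := by
  obtain ⟨c, hc, d, hd, e, he, hde, hdc, hec⟩ :=
    hC.exists_two_subset hC' hcard.le hne fun c hc d hd x hxc hxd =>
      (le_total (setSparsity X Np c) (setSparsity X Np d)).imp
        (hW'.subset_of_setSparsity_le hC' hd (hC.2.2.1 c hc) hxd hxc)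
        (hW.subset_of_setSparsity_le hC hc (hC'.2.2.1 d hd) hxc hxd)
  exact hLM'.Aell_lt_of_two_subset hC hC' hW' hc hd he hde hdc hec

/-- a weakly separable, LM-separable K-clustering is the unique such
K-clustering. -/
theorem stmt_2 {α : Type*} [MetricSpace α] (X : Finset α) (Np : ℕ)
    (hNp : 2 ≤ Np) (hNpX : Np ≤ X.card)
    (C C' : Finset (Finset α))
    (hC : IsClustering X C) (hW : WeaklySeparable X Np C) (hLM : LMSeparable X Np C)
    (hC' : IsClustering X C') (hcard : C'.card = C.card)
    (hW' : WeaklySeparable X Np C') (hLM' : LMSeparable X Np C') :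
    C' = C := by
  by_contra hne
  exact lt_asymm (Aell_lt_of_ne hC hW hC' hW' hLM' hcard.symm (Ne.symm hne))
    (Aell_lt_of_ne hC' hW' hC hW hLM hcard hne)
end

section
/- For any clustering C of X, any N_p, and any A ∈ ℝ, the following two conditions are equivalent: (1) for each c ∈ C, c is (A·min over x ∈ c of ε_{N_p}(x))-connected and A·min over x ∈ c of ε_{N_p}(x) < min over c' ∈ C with c' ≠ c of ε(c,c'); (2) for each c ∈ C and every x ∈ X_c*, the ε-cluster centered at x with radius A·ε_{N_p}(x) satisfies c*(x, A·ε_{N_p}(x)) = c. -/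
variable {α : Type*}

section

open Filter Topology

variable [MetricSpace α] {X : Finset α} {Np : ℕ} {ε δ : ℝ} {x y z : α} {c c' : Finset α}

theorem sparsity_nonneg : 0 ≤ sparsity X Np x :=
  Real.sInf_nonneg fun _ h => h.1

namespace EpsConn

theorem nonneg (h : EpsConn X Np ε x y) : 0 ≤ ε :=
  sparsity_nonneg.trans h.2.1

theorem right (h : EpsConn X Np ε x y) : y ∈ X ∧ sparsity X Np y ≤ ε := by
  obtain ⟨hx, hs, h⟩ := h
  induction h with
  | refl => exact ⟨hx, hs⟩
  | tail _ h _ => exact ⟨h.1, h.2.1⟩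

theorem trans (h₁ : EpsConn X Np ε x y) (h₂ : EpsConn X Np ε y z) : EpsConn X Np ε x z :=
  ⟨h₁.1, h₁.2.1, h₁.2.2.trans h₂.2.2⟩

theorem single (hx : x ∈ X) (hy : y ∈ X) (hsx : sparsity X Np x ≤ ε)
    (hsy : sparsity X Np y ≤ ε) (hd : dist x y ≤ ε) : EpsConn X Np ε x y :=
  ⟨hx, hsx, .single ⟨hy, hsy, hd⟩⟩

/-- Enlarging or shrinking the radius preserves connectedness as long as every sparsity and every
distance within the old radius is within the new one. -/
theorem of_imp (h : EpsConn X Np ε x y)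
    (hs : ∀ a ∈ X, sparsity X Np a ≤ ε → sparsity X Np a ≤ δ)
    (hd : ∀ a ∈ X, ∀ b ∈ X, dist a b ≤ ε → dist a b ≤ δ) : EpsConn X Np δ x y := by
  obtain ⟨hx, hsx, h⟩ := h
  induction h with
  | refl => exact ⟨hx, hs _ hx hsx, .refl⟩
  | tail _ h ih =>
    have hb := ih.right
    exact ih.trans (single hb.1 h.1 hb.2 (hs _ h.1 h.2.1) (hd _ hb.1 _ h.1 h.2.2))

theorem mono (h : EpsConn X Np ε x y) (hle : ε ≤ δ) : EpsConn X Np δ x y :=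
  h.of_imp (fun _ _ h => h.trans hle) fun _ _ _ _ h => h.trans hle

theorem symm (h : EpsConn X Np ε x y) : EpsConn X Np ε y x := by
  obtain ⟨hx, hs, h⟩ := h
  induction h with
  | refl => exact ⟨hx, hs, .refl⟩
  | tail _ h ih =>
    exact (single h.1 ih.1 h.2.1 ih.2.1 (by rw [dist_comm]; exact h.2.2)).trans ih

theorem epsDist_le (h : EpsConn X Np ε x y) : epsDist X Np x y ≤ ε :=
  csInf_le ⟨0, fun _ h => h.nonneg⟩ h

end EpsConn

theorem epsDist_nonneg : 0 ≤ epsDist X Np x y :=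
  Real.sInf_nonneg fun _ h => h.nonneg

theorem eventually_nhdsGT_le_imp_le (ε v : ℝ) : ∀ᶠ δ in 𝓝[>] ε, v ≤ δ → v ≤ ε := by
  by_cases h : v ≤ ε
  · exact .of_forall fun _ _ => h
  · filter_upwards [nhdsWithin_le_nhds (Iio_mem_nhds (not_le.1 h))] with δ hδ hv
    exact absurd hv (not_le.2 hδ)

/-- The infimum defining the `ε`-distance between points of `X` is attained. -/
theorem epsConn_epsDist (hx : x ∈ X) (hy : y ∈ X) :
    EpsConn X Np (epsDist X Np x y) x y := by
  have hne : {ε : ℝ | EpsConn X Np ε x y}.Nonempty :=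
    ⟨max (dist x y) (max (sparsity X Np x) (sparsity X Np y)),
      .single hx hy (by simp) (by simp) (by simp)⟩
  have h₁ : ∀ᶠ δ in 𝓝[>] epsDist X Np x y, ∀ a ∈ X,
      sparsity X Np a ≤ δ → sparsity X Np a ≤ epsDist X Np x y :=
    (Finset.eventually_all X).2 fun a _ => eventually_nhdsGT_le_imp_le _ _
  have h₂ : ∀ᶠ δ in 𝓝[>] epsDist X Np x y, ∀ a ∈ X, ∀ b ∈ X,
      dist a b ≤ δ → dist a b ≤ epsDist X Np x y :=
    (Finset.eventually_all X).2 fun a _ => (Finset.eventually_all X).2 fun b _ =>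
      eventually_nhdsGT_le_imp_le _ _
  obtain ⟨δ, hs, hd, hδ⟩ := (h₁.and (h₂.and self_mem_nhdsWithin)).exists
  obtain ⟨ε, hε, hlt⟩ := exists_lt_of_csInf_lt hne hδ
  exact (EpsConn.mono hε hlt.le).of_imp hs hd

theorem epsConn_iff_epsDist_le (hx : x ∈ X) (hy : y ∈ X) :
    EpsConn X Np ε x y ↔ epsDist X Np x y ≤ ε :=
  ⟨EpsConn.epsDist_le, (epsConn_epsDist hx hy).mono⟩

theorem clusterDist_le (hx : x ∈ c) (hy : y ∈ c') :
    clusterDist X Np c c' ≤ epsDist X Np x y :=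
  csInf_le ⟨0, by rintro _ ⟨a, _, b, _, rfl⟩; exact epsDist_nonneg⟩ ⟨x, hx, y, hy, rfl⟩

theorem exists_clusterDist_eq (hc : c.Nonempty) (hc' : c'.Nonempty) :
    ∃ x ∈ c, ∃ y ∈ c', clusterDist X Np c c' = epsDist X Np x y := by
  obtain ⟨x, hx⟩ := hc
  obtain ⟨y, hy⟩ := hc'
  have hfin : {e : ℝ | ∃ x ∈ c, ∃ y ∈ c', e = epsDist X Np x y}.Finite := by
    refine ((c ×ˢ c').finite_toSet.image fun p => epsDist X Np p.1 p.2).subset ?_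
    rintro _ ⟨a, ha, b, hb, rfl⟩
    exact ⟨(a, b), by simp [ha, hb], rfl⟩
  have hne : {e : ℝ | ∃ x ∈ c, ∃ y ∈ c', e = epsDist X Np x y}.Nonempty :=
    ⟨_, x, hx, y, hy, rfl⟩
  exact hne.csInf_mem hfin

theorem mem_minSparsityPts :
    x ∈ minSparsityPts X Np c ↔ x ∈ c ∧ ∀ y ∈ c, sparsity X Np x ≤ sparsity X Np y := by
  simp [minSparsityPts]

theorem minSparsityPts_nonempty (hc : c.Nonempty) : (minSparsityPts X Np c).Nonempty := by
  obtain ⟨x, hx⟩ := c.exists_min_image (sparsity X Np) hc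
  exact ⟨x, mem_minSparsityPts.2 hx⟩

theorem minSpars_eq (hx : x ∈ minSparsityPts X Np c) : minSpars X Np c = sparsity X Np x := by
  rw [mem_minSparsityPts] at hx
  refine IsLeast.csInf_eq ⟨⟨x, hx.1, rfl⟩, ?_⟩
  rintro _ ⟨y, hy, rfl⟩
  exact hx.2 y hy

end

/-- the two defining conditions of strong separability (for a fixed A)
are equivalent. -/
theorem stmt_7 {α : Type*} [MetricSpace α] (X : Finset α) (Np : ℕ)
    (hNp : 0 < Np) (hNpX : Np ≤ X.card)
    (C : Finset (Finset α)) (hC : IsClustering X C) (A : ℝ) :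
    (∀ c ∈ C, SetConn X Np (A * minSpars X Np c) c ∧
      ∀ c' ∈ C, c' ≠ c → A * minSpars X Np c < clusterDist X Np c c') ↔
    (∀ c ∈ C, ∀ x ∈ minSparsityPts X Np c,
      epsClusterAt X Np (A * sparsity X Np x) x = (c : Set α)) := by
  obtain ⟨hne, hdisj, hsub, hcover⟩ := hC
  constructor
  · intro h c hc x hx
    obtain ⟨hconn, hsep⟩ := h c hc
    rw [← minSpars_eq hx]
    have hxc := (mem_minSparsityPts.1 hx).1
    ext y
    refine ⟨fun hy => ?_, fun hy => hconn x hxc y hy⟩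
    change EpsConn X Np _ x y at hy
    obtain ⟨c', hc', hyc'⟩ := hcover y hy.right.1
    by_cases hcc : c' = c
    · exact hcc ▸ hyc'
    · exact absurd (hsep c' hc' hcc) (not_lt.2 ((clusterDist_le hxc hyc').trans hy.epsDist_le))
  · intro h c hc
    obtain ⟨x, hx⟩ := minSparsityPts_nonempty (X := X) (Np := Np) (hne c hc)
    have hmem : ∀ y, EpsConn X Np (A * minSpars X Np c) x y ↔ y ∈ c := fun y => by
      rw [minSpars_eq hx]
      exact Set.ext_iff.1 (h c hc x hx) y
    refine ⟨fun y hy z hz => ((hmem y).2 hy).symm.trans ((hmem z).2 hz), fun c' hc' hcc => ?_⟩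
    by_contra! hle
    obtain ⟨a, ha, b, hb, hab⟩ :=
      exists_clusterDist_eq (X := X) (Np := Np) (hne c hc) (hne c' hc')
    rw [hab, ← epsConn_iff_epsDist_le (hsub c hc ha) (hsub c' hc' hb)] at hle
    exact Finset.disjoint_left.1 (hdisj c' hc' c hc hcc) hb
      ((hmem b).1 (((hmem a).2 ha).trans hle))
end
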